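/- Let G be a simple odd multi-cactus different from K2, with bipartition classes X and Y, and let v be any vertex of G, say v ∈ X. Then there exists a {0,1}-weighting of G such that v has weighted degree 1, every vertex of the bipartition class not containing v has weighted degree 1, and every other vertex (every vertex of X other than v) has weighted degree 0 or 2. -/

import Mathlib

open scoped Classical

/-- The weighted degree of vertex `v` under edge-weighting `w`:
the sum of the weights of the edges incident with `v`. -/
noncomputable def wdeg {V : Type} [Fintype V] (G : SimpleGraph V) (w : Sym2 V → ℕ) (v : V) : ℕ :=
  ∑ u ∈ Finset.univ.filter (fun u => G.Adj v u), w s(v, u)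

/-- `w` is a `{0,1}`-weighting of `G`: every edge gets weight `0` or `1`. -/
def Is01Weighting {V : Type} (G : SimpleGraph V) (w : Sym2 V → ℕ) : Prop :=
  ∀ e ∈ G.edgeSet, w e = 0 ∨ w e = 1

/-- `G` has the `{0,1}`-property: it admits a proper (neighbour sum-distinguishing)
`{0,1}`-edge-weighting. A graph without this property is called *bad*. -/
def HasZeroOneProperty {V : Type} [Fintype V] (G : SimpleGraph V) : Prop :=
  ∃ w : Sym2 V → ℕ, Is01Weighting G w ∧
    ∀ ⦃u v : V⦄, G.Adj u v → wdeg G w u ≠ wdeg G w v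
/-- The `i`-th vertex of a path from `u` to `v` with `n` fresh internal vertices. -/
def pathVert {V : Type} (u v : V) (n : ℕ) (i : Fin (n + 2)) : V ⊕ Fin n :=
  if h0 : i.1 = 0 then Sum.inl u
  else if hn : i.1 ≤ n then Sum.inr ⟨i.1 - 1, by omega⟩
  else Sum.inl v

/-- The edges of a path of length `n + 1` from `u` to `v` with `n` fresh internal vertices. -/
def pathEdges {V : Type} (u v : V) (n : ℕ) : Set (Sym2 (V ⊕ Fin n)) :=
  {e | ∃ i : Fin (n + 1), e = s(pathVert u v n i.castSucc, pathVert u v n i.succ)}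

/-- The green edges of such a path, coloured alternately red, green, …, green, red
(so the `i`-th edge is green exactly when `i` is odd). -/
def greenPathEdges {V : Type} (u v : V) (n : ℕ) : Set (Sym2 (V ⊕ Fin n)) :=
  {e | ∃ i : Fin (n + 1), Odd i.1 ∧ e = s(pathVert u v n i.castSucc, pathVert u v n i.succ)}

/-- The graph obtained from `G` by adding a path of length `n + 1` from `u` to `v`,
internally disjoint from `G` (its `n` internal vertices are fresh). -/
def addPathGraph {V : Type} (G : SimpleGraph V) (u v : V) (n : ℕ) :
    SimpleGraph (V ⊕ Fin n) :=
  SimpleGraph.fromEdgeSet ((Sym2.map Sum.inl '' G.edgeSet) ∪ pathEdges u v n)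

/-- The recursion building simple odd multi-cacti together with their red-green
edge-colouring (given by the set of green edges): `K₂` with its unique edge green is a simple
odd multi-cactus, and one may repeatedly add, along a green edge `uv`, a new internally
disjoint path of length `l ≡ 1 [MOD 4]`, `l ≥ 5` (here `l = 4 * k + 5`), whose edges are
coloured alternately red, green, …, green, red. -/
inductive OMC : ∀ (V : Type), SimpleGraph V → Set (Sym2 V) → Prop
  | k2 : OMC (Fin 2) ⊤ ((⊤ : SimpleGraph (Fin 2)).edgeSet)
  | addPath {V : Type} {G : SimpleGraph V} {green : Set (Sym2 V)} (h : OMC V G green)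
      (u v : V) (hadj : G.Adj u v) (hgreen : s(u, v) ∈ green) (k : ℕ) :
      OMC (V ⊕ Fin (4 * k + 4)) (addPathGraph G u v (4 * k + 4))
        (Sym2.map Sum.inl '' green ∪ greenPathEdges u v (4 * k + 4))

/-- `G` is a simple odd multi-cactus: it is isomorphic to a graph produced by the
recursion `OMC`. -/
def IsSimpleOddMultiCactus {V : Type} (G : SimpleGraph V) : Prop :=
  ∃ (W : Type) (H : SimpleGraph W) (green : Set (Sym2 W)),
    OMC W H green ∧ Nonempty (G ≃g H)

/-- The conclusion of the main theorem for a fixed graph, 2-colouring and vertex. -/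
def HasUnitWeightingAt {V : Type} [Fintype V] (G : SimpleGraph V) (c : V → Bool) (v : V) : Prop :=
  ∃ w : Sym2 V → ℕ, Is01Weighting G w ∧
    wdeg G w v = 1 ∧
    (∀ u : V, c u ≠ c v → wdeg G w u = 1) ∧
    (∀ u : V, u ≠ v → c u = c v → wdeg G w u = 0 ∨ wdeg G w u = 2)

lemma addPathGraph_adj_inl_inl {V : Type} (G : SimpleGraph V) (u v : V) {n : ℕ} (hn : 1 ≤ n)
    (a b : V) : (addPathGraph G u v n).Adj (Sum.inl a) (Sum.inl b) ↔ G.Adj a b := by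
  unfold addPathGraph
  rw [SimpleGraph.fromEdgeSet_adj]
  constructor
  · rintro ⟨(⟨e, he, hab⟩ | ⟨i, hi⟩), -⟩
    · induction e with
      | _ x y =>
        simp only [Sym2.map_mk, Sym2.eq_iff, Sum.inl.injEq] at hab
        rcases hab with ⟨rfl, rfl⟩ | ⟨rfl, rfl⟩
        · exact he
        · exact G.symm.symm _ _ he
    · exfalso
      have := i.2
      simp only [pathVert, Fin.val_castSucc, Fin.val_succ, Sym2.eq_iff] at hi
      grind
  · intro h
    exact ⟨Or.inl ⟨s(a, b), h, rfl⟩, by simpa using h.ne⟩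

lemma addPathGraph_adj_inl_inr {V : Type} (G : SimpleGraph V) (u v : V) {n : ℕ}
    (a : V) (j : Fin n) : (addPathGraph G u v n).Adj (Sum.inl a) (Sum.inr j) ↔
      (a = u ∧ j.1 = 0) ∨ (a = v ∧ j.1 + 1 = n) := by
  unfold addPathGraph
  rw [SimpleGraph.fromEdgeSet_adj]
  constructor
  · rintro ⟨(⟨e, he, hab⟩ | ⟨i, hi⟩), -⟩
    · induction e with
      | _ x y => simp at hab
    · have := i.2
      have := j.2
      simp only [pathVert, Fin.val_castSucc, Fin.val_succ, Sym2.eq_iff] at hi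
      grind
  · intro h
    refine ⟨Or.inr ?_, by simp⟩
    have := j.2
    rcases h with ⟨rfl, h⟩ | ⟨rfl, h⟩
    · refine ⟨⟨0, by omega⟩, ?_⟩
      simp only [pathVert, Fin.val_castSucc, Fin.val_succ, Sym2.eq_iff]
      grind
    · refine ⟨⟨n, by omega⟩, ?_⟩
      simp only [pathVert, Fin.val_castSucc, Fin.val_succ, Sym2.eq_iff]
      grind

lemma addPathGraph_adj_inr_inr {V : Type} (G : SimpleGraph V) (u v : V) {n : ℕ}
    (i j : Fin n) : (addPathGraph G u v n).Adj (Sum.inr i) (Sum.inr j) ↔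
      i.1 + 1 = j.1 ∨ j.1 + 1 = i.1 := by
  unfold addPathGraph
  rw [SimpleGraph.fromEdgeSet_adj]
  constructor
  · rintro ⟨(⟨e, he, hab⟩ | ⟨l, hl⟩), -⟩
    · induction e with
      | _ x y => simp at hab
    · have := l.2
      have := i.2
      have := j.2
      simp only [pathVert, Fin.val_castSucc, Fin.val_succ, Sym2.eq_iff] at hl
      grind
  · intro h
    have := i.2
    have := j.2
    refine ⟨Or.inr ?_, by simp only [ne_eq, Sum.inr.injEq, Fin.ext_iff]; omega⟩
    rcases h with h | h
    · refine ⟨⟨j, by omega⟩, ?_⟩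
      simp only [pathVert, Fin.val_castSucc, Fin.val_succ, Sym2.eq_iff]
      grind
    · refine ⟨⟨i, by omega⟩, ?_⟩
      simp only [pathVert, Fin.val_castSucc, Fin.val_succ, Sym2.eq_iff]
      grind

/-- Extends the edge-weighting `w` to an added path, whose `i`-th edge gets weight `f i`. -/
def extendWeight {V : Type} (w : Sym2 V → ℕ) (n : ℕ) (f : ℕ → ℕ) : Sym2 (V ⊕ Fin n) → ℕ :=
  Sym2.lift ⟨fun x y => match x, y with
    | Sum.inl a, Sum.inl b => w s(a, b)
    | Sum.inl _, Sum.inr j => if j.1 = 0 then f 0 else f n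
    | Sum.inr i, Sum.inl _ => if i.1 = 0 then f 0 else f n
    | Sum.inr i, Sum.inr j => f (max i.1 j.1), by
      rintro (a | i) (b | j)
      · simp only [Sym2.eq_swap]
      · rfl
      · rfl
      · simp only [max_comm]⟩

section extendWeight

variable {V : Type} (w : Sym2 V → ℕ) (n : ℕ) (f : ℕ → ℕ)

@[simp] lemma extendWeight_inl_inl (a b : V) :
    extendWeight w n f s(Sum.inl a, Sum.inl b) = w s(a, b) := rfl

@[simp] lemma extendWeight_inl_inr (a : V) (j : Fin n) :
    extendWeight w n f s(Sum.inl a, Sum.inr j) = if j.1 = 0 then f 0 else f n := rfl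

@[simp] lemma extendWeight_inr_inl (a : V) (j : Fin n) :
    extendWeight w n f s(Sum.inr j, Sum.inl a) = if j.1 = 0 then f 0 else f n := rfl

@[simp] lemma extendWeight_inr_inr (i j : Fin n) :
    extendWeight w n f s(Sum.inr i, Sum.inr j) = f (max i.1 j.1) := rfl

end extendWeight

lemma is01Weighting_extendWeight {V : Type} {G : SimpleGraph V} {w : Sym2 V → ℕ}
    (hw : Is01Weighting G w) (u v : V) {n : ℕ} (hn : 1 ≤ n) {f : ℕ → ℕ}
    (hf : ∀ i, f i = 0 ∨ f i = 1) :
    Is01Weighting (addPathGraph G u v n) (extendWeight w n f) := by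
  intro e he
  induction e with
  | _ x y =>
    rw [SimpleGraph.mem_edgeSet] at he
    rcases x with a | i <;> rcases y with b | j
    · exact hw s(a, b) ((addPathGraph_adj_inl_inl G u v hn a b).1 he)
    · rw [extendWeight_inl_inr]; split_ifs <;> exact hf _
    · rw [extendWeight_inr_inl]; split_ifs <;> exact hf _
    · exact hf _

lemma wdeg_extendWeight_inl {V : Type} [Fintype V] (G : SimpleGraph V) (w : Sym2 V → ℕ)
    {u v : V} (huv : u ≠ v) {n : ℕ} (hn : 2 ≤ n) (f : ℕ → ℕ) (a : V) :
    wdeg (addPathGraph G u v n) (extendWeight w n f) (Sum.inl a) =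
      wdeg G w a + if a = u then f 0 else if a = v then f n else 0 := by
  unfold wdeg
  rw [Finset.sum_filter, Fintype.sum_sum_type, Finset.sum_filter]
  congr 1
  · simp [addPathGraph_adj_inl_inl G u v (by omega : 1 ≤ n)]
  · simp only [addPathGraph_adj_inl_inr, extendWeight_inl_inr]
    split_ifs with h1 h2
    · subst h1
      rw [Finset.sum_eq_single (⟨0, by omega⟩ : Fin n)]
      · simp
      · intro j _ hj
        have : j.1 ≠ 0 := fun h => hj (Fin.ext h)
        simp [huv, this]
      · simp
    · subst h2
      rw [Finset.sum_eq_single (⟨n - 1, by omega⟩ : Fin n)]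
      · have h : n - 1 + 1 = n := by omega
        have h' : n - 1 ≠ 0 := by omega
        simp only [h, h', h1, and_self, or_true, if_true, if_false]
      · intro j _ hj
        have : j.1 + 1 ≠ n := fun h => hj (Fin.ext (by simp; omega))
        simp [h1, this]
      · simp
    · simp [h1, h2]

lemma wdeg_extendWeight_inr {V : Type} [Fintype V] (G : SimpleGraph V) (w : Sym2 V → ℕ)
    {u v : V} {n : ℕ} (hn : 2 ≤ n) (f : ℕ → ℕ) (i : Fin n) :
    wdeg (addPathGraph G u v n) (extendWeight w n f) (Sum.inr i) = f i + f (i + 1) := by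
  have hi := i.2
  unfold wdeg
  rw [Finset.sum_filter, Fintype.sum_sum_type]
  simp only [addPathGraph_adj_inr_inr, extendWeight_inr_inr, extendWeight_inr_inl,
    SimpleGraph.adj_comm _ (Sum.inr i) (Sum.inl _), addPathGraph_adj_inl_inr]
  have hold : (∑ x : V, if x = u ∧ i.1 = 0 ∨ x = v ∧ i.1 + 1 = n then
      (if i.1 = 0 then f 0 else f n) else 0) =
      (if i.1 = 0 then f 0 else 0) + if i.1 + 1 = n then f n else 0 := by
    by_cases h0 : i.1 = 0
    · have : i.1 + 1 ≠ n := by omega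
      simp [h0, show ¬ (1 = n) by omega]
    · by_cases h1 : i.1 + 1 = n <;> simp [h0, h1]
  have hnew : (∑ j : Fin n, if i.1 + 1 = j.1 ∨ j.1 + 1 = i.1 then f (max i.1 j.1) else 0) =
      (if i.1 = 0 then 0 else f i) + if i.1 + 1 = n then 0 else f (i + 1) := by
    have hsplit : ∀ j : Fin n,
        (if i.1 + 1 = j.1 ∨ j.1 + 1 = i.1 then f (max i.1 j.1) else 0) =
        (if j.1 + 1 = i.1 then f i else 0) + if i.1 + 1 = j.1 then f (i + 1) else 0 := by
      intro j
      split_ifs with h1 h2 h3 h4 h5 h6 <;> first | omega | skip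
      · rw [max_eq_left (by omega), add_zero]
      · rw [max_eq_right (by omega), h4, zero_add]
    rw [Finset.sum_congr rfl (fun j _ => hsplit j), Finset.sum_add_distrib]
    congr 1
    · split_ifs with h0
      · simp [h0]
      · rw [Finset.sum_eq_single (⟨i.1 - 1, by omega⟩ : Fin n)]
        · simp [show i.1 - 1 + 1 = i.1 by omega]
        · intro j _ hj
          rw [if_neg fun h => hj (Fin.ext (by simp; omega))]
        · simp
    · split_ifs with h0
      · exact Finset.sum_eq_zero fun j _ => if_neg (by have := j.2; omega)
      · rw [Finset.sum_eq_single (⟨i.1 + 1, by omega⟩ : Fin n)]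
        · simp
        · intro j _ hj
          rw [if_neg fun h => hj (Fin.ext h.symm)]
        · simp
  rw [hold, hnew]
  split_ifs with h0 h1 h1
  · omega
  · simp [h0]
  · simp [h1, add_comm]
  · simp

lemma color_inr_eq_iff {V : Type} {G : SimpleGraph V} {u v : V} {n : ℕ}
    {c : V ⊕ Fin n → Bool}
    (hc : ∀ ⦃x y⦄, (addPathGraph G u v n).Adj x y → c x ≠ c y) (i : Fin n) :
    c (Sum.inr i) = c (Sum.inl u) ↔ i.1 % 2 = 1 := by
  obtain ⟨i, hi⟩ := i
  induction i with
  | zero =>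
    have := hc ((addPathGraph_adj_inl_inr G u v u ⟨0, hi⟩).2 (Or.inl ⟨rfl, rfl⟩))
    simpa using this.symm
  | succ i ih =>
    have h1 := ih (by omega)
    have h2 := hc ((addPathGraph_adj_inr_inr G u v ⟨i, by omega⟩ ⟨i + 1, hi⟩).2 (Or.inl rfl))
    have h3 : c (Sum.inr ⟨i + 1, hi⟩) = c (Sum.inl u) ↔
        ¬ c (Sum.inr ⟨i, by omega⟩) = c (Sum.inl u) := by
      revert h2
      generalize c (Sum.inr ⟨i + 1, hi⟩) = p
      generalize c (Sum.inr ⟨i, _⟩) = q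
      generalize c (Sum.inl u) = r
      revert p q r
      decide
    rw [h3, h1]
    simp only
    omega

/-- Adding a path of length `≡ 1 [MOD 4]` along an edge preserves `HasUnitWeightingAt`. -/
lemma hasUnitWeightingAt_addPathGraph {V : Type} [Fintype V] {G : SimpleGraph V}
    (ih : ∀ c : V → Bool, (∀ ⦃x y⦄, G.Adj x y → c x ≠ c y) → ∀ v, HasUnitWeightingAt G c v)
    {u v : V} (hadj : G.Adj u v) (k : ℕ) (c : V ⊕ Fin (4 * k + 4) → Bool)
    (hc : ∀ ⦃x y⦄, (addPathGraph G u v (4 * k + 4)).Adj x y → c x ≠ c y)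
    (x : V ⊕ Fin (4 * k + 4)) :
    HasUnitWeightingAt (addPathGraph G u v (4 * k + 4)) c x := by
  have hcG : ∀ ⦃x y⦄, G.Adj x y → c (Sum.inl x) ≠ c (Sum.inl y) := fun a b hab =>
    hc ((addPathGraph_adj_inl_inl G u v (by omega) a b).2 hab)
  have hcol := color_inr_eq_iff hc
  have huv := hcG hadj
  have hcolv : ∀ z, c z = c (Sum.inl v) ↔ c z ≠ c (Sum.inl u) := fun z => by
    rw [Bool.eq_not.2 huv.symm, Bool.eq_not]
  have key : ∀ (y : V) (f : ℕ → ℕ), (∀ i, f i = 0 ∨ f i = 1) →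
      (∀ w : Sym2 V → ℕ, wdeg G w y = 1 →
        (∀ a, c (Sum.inl a) ≠ c (Sum.inl y) → wdeg G w a = 1) →
        (∀ a, a ≠ y → c (Sum.inl a) = c (Sum.inl y) → wdeg G w a = 0 ∨ wdeg G w a = 2) →
        let d : V ⊕ Fin (4 * k + 4) → ℕ := Sum.elim
          (fun a => wdeg G w a + if a = u then f 0 else if a = v then f (4 * k + 4) else 0)
          (fun i => f i.1 + f (i.1 + 1))
        d x = 1 ∧ (∀ z, c z ≠ c x → d z = 1) ∧
          ∀ z, z ≠ x → c z = c x → d z = 0 ∨ d z = 2) →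
      HasUnitWeightingAt (addPathGraph G u v (4 * k + 4)) c x := by
    intro y f hf h
    obtain ⟨w, hw, h1, h2, h3⟩ := ih (fun a => c (Sum.inl a)) hcG y
    refine ⟨extendWeight w _ f, is01Weighting_extendWeight hw u v (by omega) hf, ?_⟩
    have hd : wdeg (addPathGraph G u v (4 * k + 4)) (extendWeight w _ f) = Sum.elim
        (fun a => wdeg G w a + if a = u then f 0 else if a = v then f (4 * k + 4) else 0)
        (fun i => f i.1 + f (i.1 + 1)) := by
      funext z
      rcases z with a | i
      · exact wdeg_extendWeight_inl G w hadj.ne (by omega) f a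
      · exact wdeg_extendWeight_inr G w (by omega) f i
    rw [hd]
    exact h w h1 h2 h3
  rcases x with a | j
  · by_cases hau : c (Sum.inl a) = c (Sum.inl u)
    · refine key a (fun i => if i % 4 = 1 ∨ i % 4 = 2 then 1 else 0) (by grind) ?_
      intro w h1 h2 h3 d
      refine ⟨by grind, ?_, ?_⟩
      · rintro (b | i) hb
        · grind
        · have := hcol i
          grind
      · rintro (b | i) hne hb
        · rw [ne_eq, Sum.inl.injEq] at hne
          grind
        · have := hcol i
          grind
    · have hav : c (Sum.inl a) = c (Sum.inl v) := (hcolv _).2 hau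
      refine key a (fun i => if i % 4 = 2 ∨ i % 4 = 3 then 1 else 0) (by grind) ?_
      intro w h1 h2 h3 d
      refine ⟨by grind, ?_, ?_⟩
      · rintro (b | i) hb
        · grind
        · have := hcol i
          have := hcolv (Sum.inr i)
          grind
      · rintro (b | i) hne hb
        · rw [ne_eq, Sum.inl.injEq] at hne
          grind
        · have := hcol i
          have := hcolv (Sum.inr i)
          grind
  · have hj := hcol j
    have hjlt := j.2
    by_cases hju : c (Sum.inr j) = c (Sum.inl u)
    · refine key u (fun i => if i ≤ j.1 then (if i % 4 = 0 ∨ i % 4 = 3 then 1 else 0)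
        else if i % 4 = 1 ∨ i % 4 = 2 then 1 else 0) (by grind) ?_
      intro w h1 h2 h3 d
      refine ⟨by grind, ?_, ?_⟩
      · rintro (b | i) hb
        · grind
        · have := hcol i
          grind
      · rintro (b | i) hne hb
        · grind
        · have := hcol i
          have : i.1 ≠ j.1 := fun h => hne (congrArg Sum.inr (Fin.ext h))
          grind
    · have hjv : c (Sum.inr j) = c (Sum.inl v) := (hcolv _).2 hju
      refine key v (fun i => if i ≤ j.1 then (if i % 4 = 2 ∨ i % 4 = 3 then 1 else 0)
        else if i % 4 = 0 ∨ i % 4 = 1 then 1 else 0) (by grind) ?_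
      intro w h1 h2 h3 d
      refine ⟨by grind, ?_, ?_⟩
      · rintro (b | i) hb
        · grind
        · have := hcol i
          grind
      · rintro (b | i) hne hb
        · grind
        · have := hcol i
          have : i.1 ≠ j.1 := fun h => hne (congrArg Sum.inr (Fin.ext h))
          grind

lemma OMC.hasUnitWeightingAt {V : Type} {G : SimpleGraph V} {green : Set (Sym2 V)}
    (h : OMC V G green) : ∀ [Fintype V] (c : V → Bool), (∀ ⦃x y⦄, G.Adj x y → c x ≠ c y) →
      ∀ v : V, HasUnitWeightingAt G c v := by
  induction h with
  | k2 =>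
    intro inst c hc v
    obtain rfl : inst = Fin.fintype 2 := Subsingleton.elim _ _
    have hdeg : ∀ x : Fin 2, wdeg (⊤ : SimpleGraph (Fin 2)) (fun _ => 1) x = 1 := by
      intro x
      unfold wdeg
      rw [Finset.sum_filter]
      fin_cases x <;> simp
    refine ⟨fun _ => 1, fun _ _ => Or.inr rfl, hdeg v, fun u _ => hdeg u, fun u hu hcu => ?_⟩
    exact absurd hcu (hc hu)
  | @addPath V G green _ u w hadj _ k ih =>
    intro inst c hc v
    have : Fintype V := Fintype.ofInjective (Sum.inl : V → V ⊕ Fin (4 * k + 4)) Sum.inl_injective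
    obtain rfl : inst = instFintypeSum V (Fin (4 * k + 4)) := Subsingleton.elim _ _
    exact hasUnitWeightingAt_addPathGraph (fun c hc v => ih c hc v) hadj k c hc v

lemma wdeg_comp_iso {V W : Type} [Fintype V] [Fintype W] {G : SimpleGraph V} {H : SimpleGraph W}
    (φ : G ≃g H) (w : Sym2 W → ℕ) (v : V) :
    wdeg G (fun e => w (e.map φ)) v = wdeg H w (φ v) := by
  unfold wdeg
  rw [Finset.sum_filter, Finset.sum_filter]
  refine Fintype.sum_equiv φ.toEquiv _ _ fun x => if_congr φ.map_adj_iff.symm rfl rfl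

/-- In a simple odd multi-cactus different from `K₂`, with bipartition
given by the proper 2-colouring `c`, for any vertex `v` there is a `{0,1}`-weighting
under which `v` and all vertices of the opposite bipartition class have weighted degree `1`,
while every other vertex of `v`'s class has weighted degree `0` or `2`. -/
theorem statement2 {V : Type} [Fintype V] (G : SimpleGraph V)
    (h : IsSimpleOddMultiCactus G) (hK2 : ¬ Nonempty (G ≃g (⊤ : SimpleGraph (Fin 2))))
    (c : V → Bool) (hc : ∀ ⦃x y : V⦄, G.Adj x y → c x ≠ c y) (v : V) :
    ∃ w : Sym2 V → ℕ, Is01Weighting G w ∧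
      wdeg G w v = 1 ∧
      (∀ u : V, c u ≠ c v → wdeg G w u = 1) ∧
      (∀ u : V, u ≠ v → c u = c v → wdeg G w u = 0 ∨ wdeg G w u = 2) := by
  obtain ⟨W, H, green, hH, ⟨φ⟩⟩ := h
  have : Fintype W := Fintype.ofEquiv V φ.toEquiv
  obtain ⟨w, hw, h1, h2, h3⟩ := hH.hasUnitWeightingAt (fun x => c (φ.symm x))
    (fun x y hxy => hc (φ.symm.map_adj_iff.2 hxy)) (φ v)
  refine ⟨fun e => w (e.map φ), ?_, ?_, ?_, ?_⟩
  · intro e he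
    induction e with
    | _ x y => exact hw s(φ x, φ y) (φ.map_adj_iff.2 he)
  · rw [wdeg_comp_iso, h1]
  · intro u hu
    rw [wdeg_comp_iso]
    exact h2 _ (by simpa using hu)
  · intro u hne hu
    rw [wdeg_comp_iso]
    exact h3 _ (by simpa using hne) (by simpa using hu)
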